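/- Let E be a Polish space and (P_t)_{t≥0} a Feller Markov semigroup that is locally weakly irreducible at x₀ and satisfies the ASF+ property with a bounded non-decreasing function F : [0,∞) → [0,∞). Assume furthermore the separation property: for any two distinct ergodic invariant probability measures μ₁, μ₂ and any points w₁ ∈ supp(μ₁), w₂ ∈ supp(μ₂), d(w₁, w₂) ≥ 1/F(d(w₁,x₀) ∨ d(w₂,x₀)). Then (P_t) has at most one invariant probability measure. -/

import Mathlib

open MeasureTheory Metric Filter
open scoped NNReal ENNReal BoundedContinuousFunction

/-- `μ` is an invariant probability measure for the Markov semigroup `P`. -/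
def IsInvariantProb {E : Type*} [MeasurableSpace E]
    (P : ℝ → E → Measure E) (μ : Measure E) : Prop :=
  IsProbabilityMeasure μ ∧
    ∀ t : ℝ, 0 ≤ t → ∀ A : Set E, MeasurableSet A → μ A = ∫⁻ z, P t z A ∂μ

/-- `μ` is an ergodic invariant probability measure for the Markov semigroup `P`:
it is invariant and every `P`-invariant set has measure `0` or `1`. -/
def IsErgodicInvariantProb {E : Type*} [MeasurableSpace E]
    (P : ℝ → E → Measure E) (μ : Measure E) : Prop :=
  IsInvariantProb P μ ∧
    ∀ A : Set E, MeasurableSet A →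
      (∀ t : ℝ, 0 ≤ t → ∀ᵐ z ∂μ, P t z A = A.indicator (fun _ => (1 : ℝ≥0∞)) z) →
      μ A = 0 ∨ μ A = 1

/-- The (topological) support of a measure on a metric space. -/
def measSupport {E : Type*} [MetricSpace E] [MeasurableSpace E] (μ : Measure E) : Set E :=
  {z | ∀ ε > (0 : ℝ), 0 < μ (ball z ε)}


section Helpers

variable {E : Type*} [MetricSpace E] [MeasurableSpace E] [BorelSpace E]

/-- Feller kernels are measurable. -/
theorem feller_measurable (κ : E → Measure E) (hP : ∀ x, IsProbabilityMeasure (κ x))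
    (hFeller : ∀ φ : E →ᵇ ℝ, Continuous fun x => ∫ z, φ z ∂(κ x)) : Measurable κ := by
  refine Measurable.measure_of_isPiSystem_of_isProbabilityMeasure
    (S := {s | IsClosed s}) ?_ isPiSystem_isClosed ?_
  · rw [BorelSpace.measurable_eq (α := E), borel_eq_generateFrom_isClosed]
  · intro s hs
    have hpos : ∀ n : ℕ, (0:ℝ) < 1 / ((n:ℝ) + 1) := fun n => by positivity
    have hlim := fun a => tendsto_lintegral_thickenedIndicator_of_isClosed (κ a) hs hpos
      tendsto_one_div_add_atTop_nhds_zero_nat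
    refine measurable_of_tendsto_metrizable (f := fun n a =>
      ∫⁻ ω, (thickenedIndicator (hpos n) s ω : ℝ≥0∞) ∂(κ a)) ?_ (tendsto_pi_nhds.2 hlim)
    intro n
    have heq : (fun a => ∫⁻ ω, (thickenedIndicator (hpos n) s ω : ℝ≥0∞) ∂(κ a))
        = fun a => ENNReal.ofReal (∫ ω, (thickenedIndicator (hpos n) s ω : ℝ) ∂(κ a)) := by
      funext a
      rw [lintegral_coe_eq_integral]
      exact integrable_thickenedIndicator s (hpos n)
    rw [heq]
    let φ : E →ᵇ ℝ := BoundedContinuousFunction.ofNormedAddCommGroup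
      (fun ω => (thickenedIndicator (hpos n) s ω : ℝ)) (by fun_prop) 1
      (fun x => by simpa using thickenedIndicator_le_one (hpos n) s x)
    exact (hFeller φ).measurable.ennreal_ofReal

theorem le_sub_add_self' {X : Type*} [MeasurableSpace X] (μ ν : Measure X) [IsFiniteMeasure μ]
    [IsFiniteMeasure ν] : μ ≤ (μ - ν) + ν := by
  obtain ⟨s, hs⟩ := exists_isHahnDecomposition μ ν
  have hm := hs.measurableSet
  have h2 : μ.restrict sᶜ ≤ ((μ - ν) + ν).restrict sᶜ := by
    rw [Measure.restrict_add, Measure.restrict_sub_eq_restrict_sub_restrict hm.compl,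
      Measure.sub_add_cancel_of_le hs.ge_on_compl]
  have h1 : μ.restrict s ≤ ((μ - ν) + ν).restrict s := by
    rw [Measure.restrict_add]
    exact hs.le_on.trans (Measure.le_add_left le_rfl)
  calc μ = μ.restrict s + μ.restrict sᶜ := (Measure.restrict_add_restrict_compl hm).symm
    _ ≤ _ := add_le_add h1 h2
    _ = _ := Measure.restrict_add_restrict_compl hm

theorem sub_bind {X : Type*} [MeasurableSpace X] (κ : X → Measure X) (hκ : Measurable κ)
    (hP : ∀ x, IsProbabilityMeasure (κ x)) (μ ν : Measure X)
    [IsFiniteMeasure μ] [IsFiniteMeasure ν]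
    (hμ : μ.bind κ = μ) (hν : ν.bind κ = ν) : (μ - ν).bind κ = μ - ν := by
  have huniv : ∀ ρ : Measure X, ρ.bind κ Set.univ = ρ Set.univ := by
    intro ρ
    rw [Measure.bind_apply MeasurableSet.univ hκ.aemeasurable]
    simp
  symm
  refine Measure.eq_of_le_of_measure_univ_eq ?_ (huniv _).symm
  apply Measure.sub_le_of_le_add
  rw [Measure.le_iff]
  intro s hs
  have h := Measure.le_iff.1 (le_sub_add_self' μ ν)
  calc μ s = ∫⁻ x, κ x s ∂μ := by
        conv_lhs => rw [← hμ, Measure.bind_apply hs hκ.aemeasurable]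
    _ ≤ ∫⁻ x, κ x s ∂((μ - ν) + ν) := lintegral_mono' (le_sub_add_self' μ ν) le_rfl
    _ = ∫⁻ x, κ x s ∂(μ - ν) + ∫⁻ x, κ x s ∂ν := lintegral_add_measure _ _ _
    _ = _ := by
        rw [Measure.add_apply, Measure.bind_apply hs hκ.aemeasurable,
          ← Measure.bind_apply hs hκ.aemeasurable (m := ν), hν]

theorem exists_small {X : Type*} [MeasurableSpace X] (κ : X → Measure X) (hκ : Measurable κ)
    (ρ : Measure X) [IsFiniteMeasure ρ] (hρ : ρ.bind κ = ρ) (A : Set X) (hA : MeasurableSet A)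
    (f : X → ℝ≥0∞) (hf : Measurable f) (h : ∫⁻ x, f x ∂ρ < 4⁻¹ * ρ A) :
    ∃ x ∈ A, ∫⁻ z, f z ∂(κ x) < 4⁻¹ := by
  by_contra! hcon
  refine absurd h (not_lt.2 ?_)
  conv_rhs => rw [← hρ, Measure.lintegral_bind hκ.aemeasurable hf.aemeasurable]
  calc 4⁻¹ * ρ A = ∫⁻ _ in A, 4⁻¹ ∂ρ := by simp
    _ ≤ ∫⁻ x in A, ∫⁻ z, f z ∂(κ x) ∂ρ := setLIntegral_mono' hA hcon
    _ ≤ _ := setLIntegral_le_lintegral _ _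

/-- Two mutually singular finite measures are nearly separated by a Lipschitz function. -/
theorem exists_lip (ρ₁ ρ₂ : Measure E) [IsFiniteMeasure ρ₁] [IsFiniteMeasure ρ₂]
    (h : ρ₁.MutuallySingular ρ₂) (η : ℝ≥0∞) (hη : 0 < η) :
    ∃ (K : ℝ≥0) (φ : E → ℝ≥0), LipschitzWith K φ ∧ (∀ x, φ x ≤ 1) ∧
      ∫⁻ x, (φ x : ℝ≥0∞) ∂ρ₂ < η ∧ ∫⁻ x, ((1 - φ x : ℝ≥0) : ℝ≥0∞) ∂ρ₁ < η := by
  obtain ⟨s, hs, h1, h2⟩ := h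
  obtain ⟨K, hKs, hK, hlt⟩ := hs.compl.exists_isClosed_sdiff_lt (measure_ne_top ρ₁ _) hη.ne'
  have hK2 : ρ₂ K = 0 := measure_mono_null hKs h2
  have hKc : ρ₁ Kᶜ < η := by
    refine lt_of_le_of_lt ?_ hlt
    calc ρ₁ Kᶜ ≤ ρ₁ (s ∪ (sᶜ \ K)) := measure_mono (fun x hx => by
            by_cases hxs : x ∈ s
            · exact Or.inl hxs
            · exact Or.inr ⟨hxs, hx⟩)
      _ ≤ _ := measure_union_le _ _
      _ = _ := by rw [h1, zero_add]
  have hpos : ∀ n : ℕ, (0:ℝ) < 1 / ((n:ℝ) + 1) := fun n => by positivity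
  have hlim := tendsto_lintegral_thickenedIndicator_of_isClosed ρ₂ hK hpos
      tendsto_one_div_add_atTop_nhds_zero_nat
  rw [hK2] at hlim
  obtain ⟨n, hn⟩ := (hlim.eventually_lt_const hη).exists
  refine ⟨_, thickenedIndicator (hpos n) K, lipschitzWith_thickenedIndicator (hpos n) K,
    thickenedIndicator_le_one (hpos n) K, hn, lt_of_le_of_lt ?_ hKc⟩
  rw [← lintegral_indicator_one hK.measurableSet.compl]
  refine lintegral_mono fun x => ?_
  by_cases hx : x ∈ K
  · rw [thickenedIndicator_one (hpos n) K hx]; simp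
  · simp [hx]

/-- The core contradiction. -/
theorem core (κ : ℕ → E → Measure E) (hκ : ∀ n, Measurable (κ n))
    (hP : ∀ n x, IsProbabilityMeasure (κ n x)) (M : ℝ)
    (δseq : ℕ → ℝ) (hδlim : Tendsto δseq atTop (nhds 0))
    (hASF : ∀ n : ℕ, ∀ (K : ℝ≥0) (φ : E → ℝ), LipschitzWith K φ → (∀ z, |φ z| ≤ 1) →
      ∀ x y : E, δseq n * K ≤ 1 →
        |(∫ z, φ z ∂(κ n x)) - ∫ z, φ z ∂(κ n y)| ≤ dist x y * M * 2)
    (ρ₁ ρ₂ : Measure E) [IsFiniteMeasure ρ₁] [IsFiniteMeasure ρ₂]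
    (hs : ρ₁.MutuallySingular ρ₂) (h1 : ∀ n, ρ₁.bind (κ n) = ρ₁) (h2 : ∀ n, ρ₂.bind (κ n) = ρ₂)
    (A B : Set E) (hA : MeasurableSet A) (hB : MeasurableSet B) (hA0 : 0 < ρ₁ A) (hB0 : 0 < ρ₂ B)
    (hd : ∀ x ∈ A, ∀ y ∈ B, dist x y * M * 2 ≤ 1 / 2) : False := by
  have hη : 0 < min (4⁻¹ * ρ₁ A) (4⁻¹ * ρ₂ B) :=
    lt_min (ENNReal.mul_pos (by simp) hA0.ne') (ENNReal.mul_pos (by simp) hB0.ne')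
  obtain ⟨K, φ, hL, hle, hφ2, hφ1⟩ := exists_lip ρ₁ ρ₂ hs _ hη
  have hlim : Tendsto (fun n => δseq n * K) atTop (nhds 0) := by
    simpa using hδlim.mul_const (K : ℝ)
  obtain ⟨n, hn⟩ := (hlim.eventually_le_const one_pos).exists
  have hφm : Measurable φ := hL.continuous.measurable
  obtain ⟨x, hx, hgx⟩ := exists_small (κ n) (hκ n) ρ₁ (h1 n) A hA _
    (by fun_prop) (hφ1.trans_le (min_le_left _ _))
  obtain ⟨y, hy, hgy⟩ := exists_small (κ n) (hκ n) ρ₂ (h2 n) B hB _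
    (by fun_prop) (hφ2.trans_le (min_le_right _ _))
  have hint : ∀ w, Integrable (fun z => (φ z : ℝ)) (κ n w) := fun w =>
    Integrable.of_bound (by fun_prop) 1 (ae_of_all _ fun x => by simpa using hle x)
  have h4 : (4⁻¹ : ℝ≥0∞) = ENNReal.ofReal (1/4) := by
    rw [one_div, ENNReal.ofReal_inv_of_pos (by norm_num)]; norm_num
  rw [h4, lintegral_coe_eq_integral _ (hint y), ENNReal.ofReal_lt_ofReal_iff (by norm_num)] at hgy
  have hint' : Integrable (fun z => ((1 - φ z : ℝ≥0) : ℝ)) (κ n x) := by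
    have := (integrable_const (1:ℝ)).sub (hint x)
    refine this.congr (ae_of_all _ fun z => ?_)
    simp [NNReal.coe_sub (hle z)]
  rw [h4, lintegral_coe_eq_integral _ hint', ENNReal.ofReal_lt_ofReal_iff (by norm_num)] at hgx
  simp only [NNReal.coe_sub (hle _), NNReal.coe_one] at hgx
  rw [integral_sub (integrable_const _) (hint x)] at hgx
  simp at hgx
  have hL' : LipschitzWith K (fun z => (φ z : ℝ)) := hL
  have := hASF n K (fun z => (φ z : ℝ)) hL' (fun z => by simpa using hle z) x y hn
  have h3 := hd x hx y hy
  have := le_abs_self ((∫ z, (φ z : ℝ) ∂(κ n x)) - ∫ z, (φ z : ℝ) ∂(κ n y))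
  linarith

theorem exists_in_ball_support [SecondCountableTopology E] (κ : E → Measure E) (hκ : Measurable κ)
    (ρ : Measure E) (hρ : ρ.bind κ = ρ) (x₀ : E) (R : ℝ) (hR : 0 < ρ (ball x₀ R)) :
    ∃ x, dist x x₀ < R ∧ κ x ρ.supportᶜ = 0 := by
  have h0 : ρ.bind κ ρ.supportᶜ = 0 := by rw [hρ]; exact Measure.measure_compl_support
  have hm : MeasurableSet ρ.supportᶜ := Measure.isClosed_support.measurableSet.compl
  rw [Measure.bind_apply hm hκ.aemeasurable,
    lintegral_eq_zero_iff (f := fun a => κ a ρ.supportᶜ) ((Measure.measurable_coe hm).comp hκ)] at h0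
  by_contra! hcon
  refine hR.ne' (measure_mono_null (fun x hx => ?_) (ae_iff.1 h0))
  exact hcon x hx

theorem exists_ball_pos {X : Type*} [MetricSpace X] [MeasurableSpace X] (ρ : Measure X) (x₀ : X)
    (h : ρ ≠ 0) : ∃ n : ℕ, ∀ m ≥ n, 0 < ρ (ball x₀ m) := by
  by_contra! hcon
  apply h
  rw [← Measure.measure_univ_eq_zero, ← iUnion_ball_nat x₀]
  refine measure_iUnion_null fun n => ?_
  obtain ⟨m, hm, h0⟩ := hcon n
  exact measure_mono_null (ball_subset_ball (by exact_mod_cast hm)) (nonpos_iff_eq_zero.1 h0)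

end Helpers

theorem uniqueness_from_local_weak_irreducibility_and_ASFplus
    {E : Type*} [MetricSpace E] [CompleteSpace E] [TopologicalSpace.SeparableSpace E]
    [MeasurableSpace E] [BorelSpace E]
    (P : ℝ → E → Measure E) (hP : ∀ t x, IsProbabilityMeasure (P t x))
    -- Feller property
    (hFeller : ∀ t : ℝ, 0 ≤ t → ∀ φ : E →ᵇ ℝ, Continuous fun x => ∫ z, φ z ∂(P t x))
    (x₀ : E)
    -- ASF+ with a bounded non-decreasing F
    (F : ℝ → ℝ) (hF : Monotone F) (hFpos : ∀ u, 0 ≤ F u)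
    (M : ℝ) (hFbdd : ∀ u, F u ≤ M)
    (tseq : ℕ → ℝ) (htmono : Monotone tseq) (htpos : ∀ n, 0 ≤ tseq n)
    (δseq : ℕ → ℝ) (hδpos : ∀ n, 0 < δseq n) (hδanti : Antitone δseq)
    (hδlim : Tendsto δseq atTop (nhds 0))
    (hASF : ∀ n : ℕ, ∀ (K : ℝ≥0) (φ : E → ℝ), LipschitzWith K φ →
      ∀ C : ℝ, (∀ z, |φ z| ≤ C) → ∀ x y : E,
        |(∫ z, φ z ∂(P (tseq n) x)) - ∫ z, φ z ∂(P (tseq n) y)|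
          ≤ dist x y * F (max (dist x x₀) (dist y x₀)) * (C + δseq n * K))
    -- local weak irreducibility at x₀
    (hirr : ∀ R > (0:ℝ), ∀ ε > (0:ℝ), ∃ T > (0:ℝ), ∀ t ≥ T, ∃ c > (0:ℝ),
      ∀ x y : E, dist x x₀ < R → dist y x₀ < R →
        ∃ Γ : Measure (E × E), IsProbabilityMeasure Γ ∧
          Γ.fst = P t x ∧ Γ.snd = P t y ∧
          ENNReal.ofReal c ≤ Γ {p : E × E | dist p.1 p.2 ≤ ε})
    -- separation of supports of distinct ergodic invariant measures
    (hsep : ∀ μ₁ μ₂ : Measure E, IsErgodicInvariantProb P μ₁ → IsErgodicInvariantProb P μ₂ →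
      μ₁ ≠ μ₂ → ∀ w₁ ∈ measSupport μ₁, ∀ w₂ ∈ measSupport μ₂,
        1 / F (max (dist w₁ x₀) (dist w₂ x₀)) ≤ dist w₁ w₂) :
    ∀ μ ν : Measure E, IsInvariantProb P μ → IsInvariantProb P ν → μ = ν := by
  intro μ ν hμ hν
  have : SecondCountableTopology E := UniformSpace.secondCountable_of_separable E
  have hκ : ∀ t, 0 ≤ t → Measurable (P t) := fun t ht =>
    feller_measurable (P t) (hP t) (hFeller t ht)
  have hbind : ∀ ρ, IsInvariantProb P ρ → ∀ t, 0 ≤ t → ρ.bind (P t) = ρ := by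
    intro ρ hρ t ht
    ext s hs
    rw [Measure.bind_apply hs (hκ t ht).aemeasurable, ← hρ.2 t ht s hs]
  have hμp := hμ.1
  have hνp := hν.1
  by_contra hne
  have key : ∀ α β : Measure E, IsProbabilityMeasure α → IsProbabilityMeasure β → α ≠ β →
      α - β ≠ 0 := by
    intro α β hα hβ hαβ h0
    have h := le_sub_add_self' α β
    rw [h0, zero_add] at h
    exact hαβ (Measure.eq_of_le_of_isProbabilityMeasure h)
  have hi1 : ∀ t, 0 ≤ t → (μ - ν).bind (P t) = μ - ν := fun t ht =>
    sub_bind (P t) (hκ t ht) (hP t) μ ν (hbind μ hμ t ht) (hbind ν hν t ht)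
  have hi2 : ∀ t, 0 ≤ t → (ν - μ).bind (P t) = ν - μ := fun t ht =>
    sub_bind (P t) (hκ t ht) (hP t) ν μ (hbind ν hν t ht) (hbind μ hμ t ht)
  have hsing : (μ - ν).MutuallySingular (ν - μ) := Measure.mutually_singular_measure_sub
  obtain ⟨n1, hn1⟩ := exists_ball_pos (μ - ν) x₀ (key μ ν hμp hνp hne)
  obtain ⟨n2, hn2⟩ := exists_ball_pos (ν - μ) x₀ (key ν μ hνp hμp (Ne.symm hne))
  have hM : 0 ≤ M := (hFpos 0).trans (hFbdd 0)
  set ε : ℝ := 1 / (12 * (M + 1)) with hε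
  have hεpos : 0 < ε := by positivity
  have hεM : ε * M ≤ 1 / 12 := by
    rw [hε, div_mul_eq_mul_div, div_le_div_iff₀ (by positivity) (by norm_num)]
    linarith
  set N : ℕ := max n1 n2 + 1 with hN
  obtain ⟨T, hT, hTt⟩ := hirr N (by positivity) ε hεpos
  obtain ⟨c, hc, hcc⟩ := hTt T le_rfl
  obtain ⟨x, hx, hxs⟩ := exists_in_ball_support (P T) (hκ T hT.le) _ (hi1 T hT.le) x₀ N
    (hn1 N (by omega))
  obtain ⟨y, hy, hys⟩ := exists_in_ball_support (P T) (hκ T hT.le) _ (hi2 T hT.le) x₀ N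
    (hn2 N (by omega))
  obtain ⟨Γ, -, hf, hs, hΓ⟩ := hcc x y hx hy
  have hm1 : MeasurableSet (μ - ν).supportᶜ := Measure.isClosed_support.measurableSet.compl
  have hm2 : MeasurableSet (ν - μ).supportᶜ := Measure.isClosed_support.measurableSet.compl
  rw [← hf, Measure.fst_apply hm1] at hxs
  rw [← hs, Measure.snd_apply hm2] at hys
  have hex : ∃ p : E × E, dist p.1 p.2 ≤ ε ∧ p.1 ∈ (μ - ν).support ∧ p.2 ∈ (ν - μ).support := by
    by_contra! hcon
    have h0 : Γ {p : E × E | dist p.1 p.2 ≤ ε} = 0 := by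
      refine measure_mono_null (fun p hp => ?_) (measure_union_null hxs hys)
      by_cases hp1 : p.1 ∈ (μ - ν).support
      · exact Or.inr (hcon p hp hp1)
      · exact Or.inl hp1
    rw [h0] at hΓ
    exact absurd (ENNReal.ofReal_pos.2 hc) (not_lt.2 hΓ)
  obtain ⟨⟨w₁, w₂⟩, hw, hw1, hw2⟩ := hex
  simp only at hw hw1 hw2
  refine core (fun n => P (tseq n)) (fun n => hκ _ (htpos n)) (fun n => hP _) M δseq hδlim ?_
    (μ - ν) (ν - μ) hsing (fun n => hi1 _ (htpos n)) (fun n => hi2 _ (htpos n))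
    (ball w₁ ε) (ball w₂ ε) measurableSet_ball measurableSet_ball
    ((Measure.mem_support_iff_forall _).1 hw1 _ (ball_mem_nhds _ hεpos))
    ((Measure.mem_support_iff_forall _).1 hw2 _ (ball_mem_nhds _ hεpos)) ?_
  · intro n K φ hφ hφ1 x y hK
    refine (hASF n K φ hφ 1 hφ1 x y).trans ?_
    have hδK : 0 ≤ δseq n * K := mul_nonneg (hδpos n).le K.2
    have := hFbdd (max (dist x x₀) (dist y x₀))
    have := hFpos (max (dist x x₀) (dist y x₀))
    gcongr
    linarith
  · intro a ha b hb
    have hab : dist a b ≤ 3 * ε := by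
      have h1 := dist_triangle4 a w₁ w₂ b
      rw [mem_ball] at ha hb
      rw [dist_comm w₂ b] at h1
      linarith
    nlinarith
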